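/- Let V be a semisimple R-module isomorphic to n_1 T_1 ⊕ ... ⊕ n_r T_r with T_1,...,T_r pairwise nonisomorphic simple R-modules and n_i positive integers. Then the number of maximal R-submodules of V is the sum over i of (d_i^{n_i} − 1)/(d_i − 1), where d_i = |End_R(T_i)|. -/

import Mathlib

section MaximalSubmodules

variable {R : Type u} [Ring R]

/-- A linear map factors through a surjection whose kernel it kills. -/
theorem LinearMap.exists_eq_comp_of_ker_le {V S T : Type*} [AddCommGroup V] [Module R V]
    [AddCommGroup S] [Module R S] [AddCommGroup T] [Module R T]
    (f : V →ₗ[R] S) (g : V →ₗ[R] T) (hf : Function.Surjective f)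
    (h : LinearMap.ker f ≤ LinearMap.ker g) : ∃ a : S →ₗ[R] T, g = a ∘ₗ f := by
  refine ⟨(LinearMap.ker f).liftQ g h ∘ₗ (f.quotKerEquivOfSurjective hf).symm.toLinearMap, ?_⟩
  ext v
  have : (f.quotKerEquivOfSurjective hf).symm (f v) = (LinearMap.ker f).mkQ v := by
    rw [LinearEquiv.symm_apply_eq]
    rfl
  simp [this]

variable {ι : Type*} {T : ι → Type v} [∀ i, AddCommGroup (T i)]
  [∀ i, Module R (T i)] {n : ι → ℕ}

/-- The coefficient vector `(c₀, …, c_{k-1}, 1, 0, …, 0)`. -/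
def echelonCoeff {A : Type*} [Zero A] [One A] {m : ℕ} (k : Fin m) (c : Fin k → A) (j : Fin m) : A :=
  if h : j < k then c ⟨j, h⟩ else if j = k then 1 else 0

theorem echelonCoeff_self {A : Type*} [Zero A] [One A] {m : ℕ} (k : Fin m) (c : Fin k → A) :
    echelonCoeff k c k = 1 := by
  simp [echelonCoeff]

theorem echelonCoeff_of_lt {A : Type*} [Zero A] [One A] {m : ℕ} (k : Fin m) (c : Fin k → A)
    {j : Fin m} (h : k < j) : echelonCoeff k c j = 0 := by
  simp [echelonCoeff, h.not_gt, h.ne']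

theorem echelonCoeff_castLE {A : Type*} [Zero A] [One A] {m : ℕ} (k : Fin m) (c : Fin k → A)
    (j : Fin k) : echelonCoeff k c (j.castLE k.2.le) = c j := by
  have : j.castLE k.2.le < k := j.2
  simp [echelonCoeff, this]

/-- The position of the last `1` does not increase when passing to an echelon vector that is a
left multiple of another. -/
theorem echelonCoeff_index_le {A : Type*} [MonoidWithZero A] [Nontrivial A] {m : ℕ} {k l : Fin m}
    {c : Fin k → A} {d : Fin l → A} (a : A)
    (h : ∀ j, echelonCoeff l d j = a * echelonCoeff k c j) : l ≤ k := by
  by_contra! hlt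
  have := h l
  rw [echelonCoeff_self, echelonCoeff_of_lt k c hlt, mul_zero] at this
  exact one_ne_zero this

/-- The map `V → Tᵢ` on `V = ⨁ᵢ Tᵢ^{nᵢ}` with given coefficients in `End Tᵢ`. -/
def coeffMap (i : ι) (b : Fin (n i) → Module.End R (T i)) :
    (Π i, (Fin (n i) → T i)) →ₗ[R] T i :=
  (∑ j, b j ∘ₗ LinearMap.proj j) ∘ₗ LinearMap.proj i

theorem coeffMap_apply (i : ι) (b : Fin (n i) → Module.End R (T i))
    (x : Π i, (Fin (n i) → T i)) : coeffMap i b x = ∑ j, b j (x i j) := by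
  simp [coeffMap]

theorem coeffMap_single [DecidableEq ι] (i : ι) (b : Fin (n i) → Module.End R (T i))
    (j : Fin (n i)) (t : T i) :
    coeffMap i b (Pi.single i (Pi.single j t)) = b j t := by
  rw [coeffMap_apply, Finset.sum_eq_single j] <;> simp +contextual

theorem coeffMap_echelonCoeff_surjective (i : ι) (k : Fin (n i))
    (c : Fin k → Module.End R (T i)) :
    Function.Surjective (coeffMap i (echelonCoeff k c)) := by
  classical
  exact fun t => ⟨Pi.single i (Pi.single k t), by simp [coeffMap_single, echelonCoeff_self]⟩

/-- Every map `V → Tᵢ` is given by coefficients. -/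
theorem exists_eq_coeffMap [Finite ι] [∀ i, IsSimpleModule R (T i)]
    (hTne : ∀ i j, i ≠ j → ¬ Nonempty (T i ≃ₗ[R] T j)) (i : ι)
    (f : (Π i, (Fin (n i) → T i)) →ₗ[R] T i) : ∃ b, f = coeffMap i b := by
  classical
  refine ⟨fun j => f ∘ₗ LinearMap.single R (fun i => Fin (n i) → T i) i ∘ₗ
    LinearMap.single R (fun _ => T i) j, ?_⟩
  refine LinearMap.pi_ext' fun l => LinearMap.pi_ext' fun j => ?_
  by_cases h : l = i
  · subst h
    ext t
    simp [coeffMap_single]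
  · have hz : ∀ g : T l →ₗ[R] T i, g = 0 := fun g => by
      by_contra hg
      exact hTne l i h ⟨LinearEquiv.ofBijective g (LinearMap.bijective_of_ne_zero hg)⟩
    rw [hz (LinearMap.comp _ _), hz (LinearMap.comp (LinearMap.comp (coeffMap i _) _) _)]

/-- When all nonzero scalars are units, a nonzero vector is a left unit multiple of an echelon
vector. -/
theorem exists_eq_mul_echelonCoeff {A : Type*} [MonoidWithZero A] {m : ℕ}
    (hA : ∀ a : A, a ≠ 0 → IsUnit a) (b : Fin m → A) (hb : b ≠ 0) :
    ∃ (k : Fin m) (c : Fin k → A) (a : Aˣ), ∀ j, b j = a * echelonCoeff k c j := by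
  classical
  have hne : (Finset.univ.filter fun j => b j ≠ 0).Nonempty := by
    obtain ⟨j, hj⟩ := Function.ne_iff.1 hb
    exact ⟨j, by simpa using hj⟩
  obtain ⟨k, hk, hmax⟩ := Finset.exists_max_image _ id hne
  obtain ⟨a, ha⟩ := hA (b k) (by simpa using hk)
  refine ⟨k, fun j => a⁻¹.1 * b (j.castLE k.2.le), a, fun j => ?_⟩
  rcases lt_trichotomy j k with h | h | h
  · have := echelonCoeff_castLE k (fun j => a⁻¹.1 * b (j.castLE k.2.le)) ⟨j, h⟩
    have hj : Fin.castLE k.2.le ⟨j, h⟩ = j := rfl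
    rw [hj] at this
    rw [this, Units.mul_inv_cancel_left]
  · subst h
    rw [echelonCoeff_self, mul_one, ha]
  · rw [echelonCoeff_of_lt _ _ h, mul_zero]
    by_contra hbj
    exact (hmax j (by simpa using hbj)).not_gt h

/-- The maximal submodule of `V` cut out by an echelon vector. -/
def echelonSubmodule [∀ i, IsSimpleModule R (T i)]
    (p : Σ i, Σ k : Fin (n i), (Fin k → Module.End R (T i))) :
    {M : Submodule R (Π i, (Fin (n i) → T i)) // IsCoatom M} :=
  ⟨LinearMap.ker (coeffMap p.1 (echelonCoeff p.2.1 p.2.2)),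
    LinearMap.isCoatom_ker_of_surjective (coeffMap_echelonCoeff_surjective _ _ _)⟩

theorem echelonSubmodule_injective [∀ i, IsSimpleModule R (T i)]
    (hTne : ∀ i j, i ≠ j → ¬ Nonempty (T i ≃ₗ[R] T j)) :
    Function.Injective (echelonSubmodule (R := R) (T := T) (n := n)) := by
  classical
  rintro ⟨i, k, c⟩ ⟨l, m, d⟩ h
  have hker : LinearMap.ker (coeffMap i (echelonCoeff k c)) =
      LinearMap.ker (coeffMap l (echelonCoeff m d)) := congrArg Subtype.val h
  have hsurj := coeffMap_echelonCoeff_surjective l m d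
  obtain ⟨a, ha⟩ := LinearMap.exists_eq_comp_of_ker_le _ _
    (coeffMap_echelonCoeff_surjective i k c) hker.le
  have ha0 : a ≠ 0 := by
    rintro rfl
    have := IsSimpleModule.nontrivial R (T l)
    obtain ⟨t, ht⟩ := exists_ne (0 : T l)
    obtain ⟨x, hx⟩ := hsurj t
    rw [ha] at hx
    exact ht (by simpa using hx.symm)
  obtain rfl : i = l := by
    by_contra hil
    exact hTne i l hil ⟨LinearEquiv.ofBijective a (LinearMap.bijective_of_ne_zero ha0)⟩
  have := IsSimpleModule.nontrivial R (T i)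
  have key : ∀ {k m : Fin (n i)} {c : Fin k → Module.End R (T i)} {d : Fin m → Module.End R (T i)}
      (a : Module.End R (T i)),
      coeffMap i (echelonCoeff m d) = a ∘ₗ coeffMap i (echelonCoeff k c) →
      ∀ j, echelonCoeff m d j = a * echelonCoeff k c j := by
    intro k m c d a ha j
    ext t
    simpa [coeffMap_single] using
      LinearMap.congr_fun ha (Pi.single i (Pi.single j t))
  obtain ⟨a', ha'⟩ := LinearMap.exists_eq_comp_of_ker_le _ _ hsurj hker.ge
  obtain rfl : k = m :=
    le_antisymm (echelonCoeff_index_le a' (key a' ha')) (echelonCoeff_index_le a (key a ha))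
  have hc := key a ha
  obtain rfl : a = 1 := by simpa [echelonCoeff_self] using (hc k).symm
  obtain rfl : c = d := funext fun j => by
    simpa [echelonCoeff_castLE] using (hc (j.castLE k.2.le)).symm
  rfl

theorem echelonSubmodule_surjective [Finite ι] [∀ i, IsSimpleModule R (T i)]
    (hTne : ∀ i j, i ≠ j → ¬ Nonempty (T i ≃ₗ[R] T j)) :
    Function.Surjective (echelonSubmodule (R := R) (T := T) (n := n)) := by
  classical
  rintro ⟨M, hM⟩
  have := isSimpleModule_iff_isCoatom.2 hM
  have hne : ∃ i j, M.mkQ ∘ₗ LinearMap.single R (fun i => Fin (n i) → T i) i ∘ₗ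
      LinearMap.single R (fun _ => T i) j ≠ 0 := by
    by_contra! h
    have h0 : M.mkQ = 0 :=
      LinearMap.pi_ext' fun i => LinearMap.pi_ext' fun j => by
        rw [LinearMap.comp_assoc, h i j, LinearMap.zero_comp, LinearMap.zero_comp]
    exact hM.1 (by rw [← M.ker_mkQ, h0, LinearMap.ker_zero])
  obtain ⟨i, j, hij⟩ := hne
  let E := LinearEquiv.ofBijective _ (LinearMap.bijective_of_ne_zero hij)
  obtain ⟨b, hb⟩ := exists_eq_coeffMap hTne i (E.symm.toLinearMap ∘ₗ M.mkQ)
  have hkb : LinearMap.ker (coeffMap i b) = M := by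
    rw [← hb, LinearEquiv.ker_comp, M.ker_mkQ]
  have hb0 : b ≠ 0 := by
    rintro rfl
    refine hM.1 (hkb ▸ ?_)
    ext x
    simp [coeffMap_apply]
  obtain ⟨k, c, a, hac⟩ := exists_eq_mul_echelonCoeff
    (fun f hf => (Module.End.isUnit_iff f).2 (LinearMap.bijective_of_ne_zero hf)) b hb0
  refine ⟨⟨i, k, c⟩, Subtype.ext (Eq.trans ?_ hkb)⟩
  have ha : Function.Injective a.1 := ((Module.End.isUnit_iff a.1).1 a.isUnit).1
  ext x
  have hx : coeffMap i b x = a.1 (coeffMap i (echelonCoeff k c) x) := by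
    simp [coeffMap_apply, hac]
  simp [echelonSubmodule, hx, map_eq_zero_iff a.1 ha]

/-- The cardinality of a disjoint union over `Fin m` is a finite sum. -/
theorem Cardinal.mk_sigma_fin {m : ℕ} (f : Fin m → Type v) :
    Cardinal.mk (Σ i, f i) = ∑ i, Cardinal.mk (f i) := by
  induction m with
  | zero => simp
  | succ m ih =>
    have h : Function.Bijective (Sum.elim (fun x => ⟨0, x⟩) (fun p => ⟨p.1.succ, p.2⟩) :
        f 0 ⊕ (Σ i : Fin m, f i.succ) → Σ i, f i) := by
      constructor
      · rintro (x | ⟨i, x⟩) (y | ⟨j, y⟩) hxy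
        · simpa using hxy
        · exact absurd (congrArg Sigma.fst hxy) (Fin.succ_ne_zero j).symm
        · exact absurd (congrArg Sigma.fst hxy) (Fin.succ_ne_zero i)
        · obtain rfl : i = j := Fin.succ_injective _ (congrArg Sigma.fst hxy)
          simpa using hxy
      · rintro ⟨i, x⟩
        induction i using Fin.cases with
        | zero => exact ⟨Sum.inl x, rfl⟩
        | succ i => exact ⟨Sum.inr ⟨i, x⟩, rfl⟩
    rw [← Cardinal.mk_congr (Equiv.ofBijective _ h), Fin.sum_univ_succ, ← ih fun i => f i.succ,
      Cardinal.add_def]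

end MaximalSubmodules

/-- If `V ≅ n₁T₁ ⊕ ⋯ ⊕ n_rT_r` with the `Tᵢ` pairwise nonisomorphic simple modules,
the number of maximal submodules of `V` is `∑ᵢ (dᵢ^{nᵢ}-1)/(dᵢ-1)`, stated as the
cardinal identity `∑ᵢ ∑_{k<nᵢ} dᵢᵏ` where `dᵢ = |End_R(Tᵢ)|`. -/
theorem stmt15 (R : Type u) [Ring R] (V : Type v) [AddCommGroup V] [Module R V]
    (r : ℕ) (T : Fin r → Type v) [∀ i, AddCommGroup (T i)] [∀ i, Module R (T i)]
    (hT : ∀ i, IsSimpleModule R (T i))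
    (hTne : ∀ i j, i ≠ j → ¬ Nonempty (T i ≃ₗ[R] T j))
    (n : Fin r → ℕ) (hn : ∀ i, 0 < n i)
    (e : V ≃ₗ[R] Π i, (Fin (n i) → T i)) :
    Cardinal.mk {M : Submodule R V // IsCoatom M} =
      ∑ i : Fin r, ∑ k ∈ Finset.range (n i),
        Cardinal.mk (Module.End R (T i)) ^ k := by
  have E : {M : Submodule R V // IsCoatom M} ≃
      {M : Submodule R (Π i, (Fin (n i) → T i)) // IsCoatom M} :=
    (Submodule.orderIsoMapComap e).toEquiv.subtypeEquiv fun M =>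
      ((Submodule.orderIsoMapComap e).isCoatom_iff M).symm
  rw [Cardinal.mk_congr E, ← Cardinal.mk_congr (Equiv.ofBijective _
    ⟨echelonSubmodule_injective hTne, echelonSubmodule_surjective hTne⟩), Cardinal.mk_sigma_fin]
  refine Finset.sum_congr rfl fun i _ => ?_
  rw [Cardinal.mk_sigma_fin, Finset.sum_range]
  refine Finset.sum_congr rfl fun k _ => ?_
  simp
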